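/- Let G be a real m₁×n matrix, P a real m₂×n matrix, c ∈ ℝⁿ, h ∈ ℝ^{m₁}, q ∈ ℝ^{m₂}, and consider the linear program: minimize cᵀx subject to Gx = h and Px ≥ q. Suppose x̄ is an optimal solution of this LP, and let E = {i : (Px̄)_i = q_i} be the index set of inequality constraints tight at x̄. Then x̄ is the unique optimal solution if and only if there exists no z ∈ ℝⁿ with z ≠ 0, Gz = 0, (Pz)_i ≥ 0 for all i ∈ E, and cᵀz ≤ 0. -/

import Mathlib

open Matrix Finset

/-- A point is feasible for the LP `min cᵀx s.t. Gx = h, Px ≥ q`. -/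
def LPFeasible {m₁ m₂ n : ℕ} (G : Matrix (Fin m₁) (Fin n) ℝ)
    (P : Matrix (Fin m₂) (Fin n) ℝ) (h : Fin m₁ → ℝ) (q : Fin m₂ → ℝ)
    (x : Fin n → ℝ) : Prop :=
  G.mulVec x = h ∧ ∀ i, q i ≤ P.mulVec x i

/-- A point is an optimal solution of the LP `min cᵀx s.t. Gx = h, Px ≥ q`. -/
def LPOptimal {m₁ m₂ n : ℕ} (G : Matrix (Fin m₁) (Fin n) ℝ)
    (P : Matrix (Fin m₂) (Fin n) ℝ) (c : Fin n → ℝ) (h : Fin m₁ → ℝ) (q : Fin m₂ → ℝ)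
    (x : Fin n → ℝ) : Prop :=
  LPFeasible G P h q x ∧ ∀ y, LPFeasible G P h q y → c ⬝ᵥ x ≤ c ⬝ᵥ y

/-- Along a direction that does not decrease the inequality constraints tight at `x`, some positive
step keeps all the inequality constraints satisfied. -/
theorem exists_pos_step_feasible {ι : Type*} [Finite ι] {q a b : ι → ℝ}
    (ha : ∀ i, q i ≤ a i) (hb : ∀ i, a i = q i → 0 ≤ b i) :
    ∃ t : ℝ, 0 < t ∧ ∀ i, q i ≤ a i + t * b i := by
  have key : ∀ᶠ t : ℝ in nhdsWithin 0 (Set.Ioi 0), ∀ i, q i ≤ a i + t * b i := by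
    rw [Filter.eventually_all]
    intro i
    rcases (ha i).eq_or_lt with hi | hi
    · filter_upwards [self_mem_nhdsWithin] with t ht
      have := mul_nonneg (le_of_lt ht) (hb i hi.symm)
      linarith
    · have hc : ContinuousAt (fun t : ℝ => a i + t * b i) 0 := by fun_prop
      have hlt := hc.eventually_const_lt (u := q i) (by simpa using hi)
      exact (hlt.filter_mono nhdsWithin_le_nhds).mono fun _ ht => ht.le
  obtain ⟨t, ht, htpos⟩ := (key.and self_mem_nhdsWithin).exists
  exact ⟨t, htpos, ht⟩

/-- **Mangasarian's uniqueness condition.** An optimal solution `x̄` of the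
LP `min cᵀx s.t. Gx = h, Px ≥ q` is the unique optimal solution if and only if
there is no `z ≠ 0` with `Gz = 0`, `(Pz)_i ≥ 0` for every inequality constraint
tight at `x̄`, and `cᵀz ≤ 0`. -/
theorem mangasarian_uniqueness {m₁ m₂ n : ℕ}
    (G : Matrix (Fin m₁) (Fin n) ℝ) (P : Matrix (Fin m₂) (Fin n) ℝ)
    (c : Fin n → ℝ) (h : Fin m₁ → ℝ) (q : Fin m₂ → ℝ)
    (xbar : Fin n → ℝ) (hopt : LPOptimal G P c h q xbar) :
    (∀ x, LPOptimal G P c h q x → x = xbar) ↔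
      ¬ ∃ z : Fin n → ℝ, z ≠ 0 ∧ G.mulVec z = 0 ∧
        (∀ i, P.mulVec xbar i = q i → 0 ≤ P.mulVec z i) ∧ c ⬝ᵥ z ≤ 0 := by
  constructor
  · rintro huniq ⟨z, hz, hGz, hPz, hcz⟩
    obtain ⟨t, htpos, ht⟩ := exists_pos_step_feasible hopt.1.2 hPz
    have hx : LPOptimal G P c h q (xbar + t • z) := by
      refine ⟨⟨?_, fun i => ?_⟩, fun y hy => ?_⟩
      · rw [mulVec_add, mulVec_smul, hGz, smul_zero, add_zero, hopt.1.1]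
      · simpa [mulVec_add, mulVec_smul] using ht i
      · have hle := hopt.2 y hy
        have hnonpos := mul_nonpos_of_nonneg_of_nonpos htpos.le hcz
        rw [dotProduct_add, dotProduct_smul, smul_eq_mul]
        linarith
    exact smul_ne_zero htpos.ne' hz (by simpa using huniq _ hx)
  · intro hno x hx
    by_contra hne
    refine hno ⟨x - xbar, sub_ne_zero.mpr hne, ?_, fun i hi => ?_, ?_⟩
    · rw [mulVec_sub, hx.1.1, hopt.1.1, sub_self]
    · rw [mulVec_sub, Pi.sub_apply, hi]
      exact sub_nonneg.mpr (hx.1.2 i)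
    · rw [dotProduct_sub]
      exact sub_nonpos.mpr (hx.2 xbar hopt.1)
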